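/- In the scale-invariant mean field system, if f₂ > 1 then f_n > 0 for every even n ≥ 2; moreover, for each even n ≥ 4, the polynomial expressing f_n as a function of f₂ is strictly increasing on the interval (1, ∞). -/

import Mathlib

/-- The scale-invariant mean field system: real numbers `F n` (even `n ≥ 2`) with
`F₄ = (1/3)·F₂·(F₂−1)` and, for even `n ≥ 4`,
`F_{n+2} = (1/(n+1))·Σ F_{n₁} F_{n₂} + (1/(n+1))·F_n·(2F₂+1−4/n)`, the sum running over
ordered pairs of even integers `n₁, n₂ ≥ 4` with `n₁+n₂ = n+2`. -/
def ScaleInvSystem (F : ℕ → ℝ) : Prop :=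
  F 4 = (1 / 3) * F 2 * (F 2 - 1) ∧
  ∀ n : ℕ, Even n → 4 ≤ n →
    F (n + 2) =
      (1 / ((n : ℝ) + 1)) * (∑ n₁ ∈ Finset.range (n + 3),
          if Even n₁ ∧ 4 ≤ n₁ ∧ n₁ + 2 ≤ n then F n₁ * F (n + 2 - n₁) else 0)
        + (1 / ((n : ℝ) + 1)) * F n * (2 * F 2 + 1 - 4 / (n : ℝ))

namespace ScaleInvSystem

theorem one_lt_coeff {x : ℝ} (hx : 1 < x) {n : ℕ} (hn : 4 ≤ n) :
    1 < 2 * x + 1 - 4 / (n : ℝ) := by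
  have hn' : (4 : ℝ) ≤ n := by exact_mod_cast hn
  have h : 4 / (n : ℝ) ≤ 1 := (div_le_one (by linarith)).2 hn'
  linarith

/-- Induction over the even integers `n ≥ 4`, with step `n ↦ n + 2`. -/
theorem even_induction {P : ℕ → Prop} (base : P 4)
    (step : ∀ n, Even n → 4 ≤ n → (∀ m, Even m → 4 ≤ m → m ≤ n → P m) → P (n + 2))
    (n : ℕ) (hn : Even n) (h4 : 4 ≤ n) : P n := by
  induction n using Nat.strong_induction_on with
  | _ n ih =>
    rcases h4.eq_or_lt with rfl | h
    · exact base
    · obtain ⟨k, rfl⟩ : ∃ k, n = k + 2 := ⟨n - 2, by omega⟩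
      have hk : Even k := by grind
      exact step k hk (by grind) fun m hm hm4 hmk => ih m (by omega) hm hm4

theorem pos {F : ℕ → ℝ} (hF : ScaleInvSystem F) (h2 : 1 < F 2) (n : ℕ) (hn : Even n)
    (h4 : 4 ≤ n) : 0 < F n := by
  refine even_induction (P := fun n => 0 < F n) ?_ (fun n hn h4 ih => ?_) n hn h4
  · have : 0 < F 2 - 1 := by linarith
    have : 0 < F 2 := by linarith
    rw [hF.1]
    positivity
  · have hc := one_lt_coeff h2 h4
    have hFn := ih n hn h4 le_rfl
    rw [hF.2 n hn h4]
    refine add_pos_of_nonneg_of_pos (mul_nonneg (by positivity) (Finset.sum_nonneg ?_)) ?_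
    · intro m _
      split_ifs with h
      · exact (mul_pos (ih m h.1 h.2.1 (by omega))
          (ih (n + 2 - m) (by grind) (by omega) (by omega))).le
      · exact le_rfl
    · exact mul_pos (mul_pos (by positivity) hFn) (by linarith)

theorem lt_of_lt {F G : ℕ → ℝ} (hF : ScaleInvSystem F) (hG : ScaleInvSystem G)
    (h2 : 1 < F 2) (hFG : F 2 < G 2) (n : ℕ) (hn : Even n) (h4 : 4 ≤ n) : F n < G n := by
  refine even_induction (P := fun n => F n < G n) ?_ (fun n hn h4 ih => ?_) n hn h4
  · rw [hF.1, hG.1]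
    nlinarith
  · have hc := one_lt_coeff h2 h4
    have hFn := hF.pos h2 n hn h4
    have hlt := ih n hn h4 le_rfl
    rw [hF.2 n hn h4, hG.2 n hn h4]
    refine add_lt_add_of_le_of_lt
      (mul_le_mul_of_nonneg_left (Finset.sum_le_sum ?_) (by positivity)) ?_
    · intro m _
      split_ifs with h
      · have he : Even (n + 2 - m) := by grind
        exact mul_le_mul (ih m h.1 h.2.1 (by omega)).le
          (ih (n + 2 - m) he (by omega) (by omega)).le
          (hF.pos h2 _ he (by omega)).le (hG.pos (h2.trans hFG) m h.1 h.2.1).le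
      · exact le_rfl
    · rw [mul_assoc, mul_assoc]
      exact mul_lt_mul_of_pos_left
        (mul_lt_mul'' hlt (by linarith) hFn.le (by linarith)) (by positivity)

end ScaleInvSystem

/-- in the scale-invariant mean field system, if `f₂ > 1` then all `f_n`
(even `n ≥ 2`) are strictly positive, and for each even `n ≥ 4` the value `f_n` is a
strictly increasing function of `f₂` on `(1, ∞)` (expressed by comparing two systems). -/
theorem stmt17 (F : ℕ → ℝ) (hF : ScaleInvSystem F) (h2 : 1 < F 2) :
    (∀ n : ℕ, Even n → 2 ≤ n → 0 < F n) ∧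
    (∀ G : ℕ → ℝ, ScaleInvSystem G → F 2 < G 2 →
      ∀ n : ℕ, Even n → 4 ≤ n → F n < G n) := by
  refine ⟨fun n hn hn2 => ?_, fun G hG hFG n hn h4 => hF.lt_of_lt hG h2 hFG n hn h4⟩
  rcases hn2.eq_or_lt with rfl | h
  · linarith
  · exact hF.pos h2 n hn (by grind)
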